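/- Let X be an m×N random matrix whose entries are i.i.d. uniform on {−1,+1}, with columns x₁,…,x_N. For every ε > 0 and every constant c > 0 the following holds: if m = m(K,N) satisfies m ≤ c·K^{2−ε}·ln N, then for all sufficiently large K, m and N, the probability that max_{i≠j} (1/m)|⟨x_i, x_j⟩| > 1/(2K) is at least 1/2. -/

import Mathlib

/-- Interpretation of a uniform random bit as a Rademacher (±1) value. -/
noncomputable def rad (b : Bool) : ℝ := if b then 1 else -1

/-- For an `m×N` random matrix with i.i.d. Rademacher entries (modelled as the uniform
distribution on `Fin m → Fin N → Bool`, with `Bool` mapped to `±1`), the probability that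
the coherence `max_{i≠j} (1/m)|⟨xᵢ,xⱼ⟩|` of the columns exceeds `x`. -/
noncomputable def coherBadProb (m N : ℕ) (x : ℝ) : ℝ :=
  (({ω : Fin m → Fin N → Bool | ∃ i j : Fin N, i ≠ j ∧
      x < |∑ k : Fin m, rad (ω k i) * rad (ω k j)| / m}.ncard : ℝ)) /
    (Fintype.card (Fin m → Fin N → Bool) : ℝ)

/-- The sum of a sign vector. -/
noncomputable def radSum {m : ℕ} (v : Fin m → Bool) : ℝ := ∑ k, rad (v k)

open Classical in
/-- Number of sign vectors whose sum is at least `a`. -/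
noncomputable def tailCard (m : ℕ) (a : ℝ) : ℕ :=
  (Finset.univ.filter (fun v : Fin m → Bool => a ≤ radSum v)).card

lemma rad_mul (a b : Bool) : rad a * rad b = rad (a == b) := by
  cases a <;> cases b <;> simp [rad]

lemma rad_not (a : Bool) : rad (!a) = - rad a := by
  cases a <;> simp [rad]

lemma radSum_not {m : ℕ} (v : Fin m → Bool) : radSum (fun k => !(v k)) = - radSum v := by
  simp [radSum, rad_not]

lemma tailCard_mul (m n : ℕ) (a b : ℝ) :
    tailCard m a * tailCard n b ≤ tailCard (m + n) (a + b) := by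
  classical
  unfold tailCard
  rw [← Finset.card_product]
  refine Finset.card_le_card_of_injOn (fun p => Fin.append p.1 p.2) ?_ ?_
  · rintro ⟨u, v⟩ h
    simp only [Finset.coe_product, Set.mem_prod, Finset.mem_coe, Finset.mem_filter,
      Finset.mem_univ, true_and] at h
    simp only [Finset.mem_coe, Finset.mem_filter, Finset.mem_univ, true_and]
    have : radSum (Fin.append u v) = radSum u + radSum v := by
      simp [radSum, Fin.sum_univ_add]
    rw [this]
    linarith [h.1, h.2]
  · rintro ⟨u, v⟩ _ ⟨u', v'⟩ _ h
    simp only at h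
    have h1 : u = u' := by
      funext i
      have := congrFun h (Fin.castAdd n i)
      simpa using this
    have h2 : v = v' := by
      funext i
      have := congrFun h (Fin.natAdd m i)
      simpa using this
    rw [h1, h2]

lemma tailCard_pow (L : ℕ) (a : ℝ) (r : ℕ) :
    tailCard L a ^ r ≤ tailCard (r * L) (r * a) := by
  induction r with
  | zero =>
    classical
    rw [pow_zero, tailCard, Nat.one_le_iff_ne_zero, Finset.card_ne_zero]
    refine ⟨fun _ => true, Finset.mem_filter.2 ⟨Finset.mem_univ _, ?_⟩⟩
    rw [radSum]
    apply le_of_eq_of_le _ (Finset.sum_nonneg fun k _ => by simp [rad])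
    simp
  | succ r ih =>
    rw [pow_succ, Nat.succ_mul]
    have : ((r + 1 : ℕ) : ℝ) * a = r * a + a := by push_cast; ring
    rw [this]
    exact (Nat.mul_le_mul_right _ ih).trans (tailCard_mul _ _ _ _)

open Classical in
lemma card_le_neg (m : ℕ) (a : ℝ) :
    (Finset.univ.filter (fun v : Fin m → Bool => radSum v ≤ -a)).card ≤ tailCard m a := by
  unfold tailCard
  refine Finset.card_le_card_of_injOn (fun v k => !(v k)) ?_ ?_
  · intro v h
    simp only [Finset.mem_coe, Finset.mem_filter, Finset.mem_univ, true_and] at h ⊢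
    rw [radSum_not]
    linarith
  · intro u _ v _ h
    funext k
    have := congrFun h k
    simpa using this

open Classical in
lemma card_abs_le (m : ℕ) (a : ℝ) :
    (Finset.univ.filter (fun v : Fin m → Bool => a ≤ |radSum v|)).card ≤ 2 * tailCard m a := by
  have h : Finset.univ.filter (fun v : Fin m → Bool => a ≤ |radSum v|) ⊆
      Finset.univ.filter (fun v : Fin m → Bool => a ≤ radSum v) ∪
      Finset.univ.filter (fun v : Fin m → Bool => radSum v ≤ -a) := by
    intro v hv
    simp only [Finset.mem_union, Finset.mem_filter, Finset.mem_univ, true_and] at hv ⊢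
    rcases le_abs.1 hv with h | h
    · exact Or.inl h
    · right; linarith
  have h1 := (Finset.card_le_card h).trans (Finset.card_union_le _ _)
  have h2 := card_le_neg m a
  have h3 : (Finset.univ.filter (fun v : Fin m → Bool => a ≤ radSum v)).card = tailCard m a := rfl
  omega

lemma tailCard_zero (m : ℕ) : 2 ^ m ≤ 2 * tailCard m 0 := by
  classical
  have h := card_abs_le m 0
  simpa using h

lemma sum_cons (m : ℕ) (F : ℝ → ℝ) :
    ∑ v : Fin (m + 1) → Bool, F (radSum v) =
      ∑ v : Fin m → Bool, (F (radSum v + 1) + F (radSum v - 1)) := by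
  rw [← (Fin.consEquiv (fun _ : Fin (m + 1) => Bool)).sum_comp, Fintype.sum_prod_type,
    Fintype.sum_bool, ← Finset.sum_add_distrib]
  refine Finset.sum_congr rfl fun v _ => ?_
  simp only [Fin.consEquiv, radSum, Equiv.coe_fn_mk, Fin.sum_univ_succ, Fin.cons_zero,
    Fin.cons_succ]
  simp only [rad, if_true]
  congr 2
  · ring
  · simp only [Bool.false_eq_true, if_false]
    ring

lemma moment_two (m : ℕ) : ∑ v : Fin m → Bool, radSum v ^ 2 = 2 ^ m * m := by
  induction m with
  | zero => simp [radSum]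
  | succ m ih =>
    rw [sum_cons m (fun x => x ^ 2)]
    have : ∀ v : Fin m → Bool, ((radSum v + 1) ^ 2 + (radSum v - 1) ^ 2) =
      2 * radSum v ^ 2 + 2 := fun v => by ring
    simp only [this, Finset.sum_add_distrib, ← Finset.mul_sum, ih]
    simp
    ring

lemma moment_four (m : ℕ) : ∑ v : Fin m → Bool, radSum v ^ 4 = 2 ^ m * (3 * m ^ 2 - 2 * m) := by
  induction m with
  | zero => simp [radSum]
  | succ m ih =>
    rw [sum_cons m (fun x => x ^ 4)]
    have : ∀ v : Fin m → Bool, ((radSum v + 1) ^ 4 + (radSum v - 1) ^ 4) =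
      2 * radSum v ^ 4 + 12 * radSum v ^ 2 + 2 := fun v => by ring
    simp only [this, Finset.sum_add_distrib, ← Finset.mul_sum, ih, moment_two]
    simp
    ring

lemma tailCard_const (L : ℕ) (hL : 1 ≤ L) : 2 ^ L ≤ 32 * tailCard L (√L / 2) := by
  classical
  have hL' : (1 : ℝ) ≤ L := by exact_mod_cast hL
  have key : ∀ v : Fin L → Bool,
      (1 / 4 : ℝ) * (radSum v ^ 2 - L / 4) * (17 / 4 * L - radSum v ^ 2) ≤
        (L : ℝ) ^ 2 * (if √L / 2 ≤ |radSum v| then 1 else 0) := by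
    intro v
    split_ifs with h
    · nlinarith [sq_nonneg (radSum v ^ 2 - 9 / 4 * L)]
    · push Not at h
      have h1 : radSum v ^ 2 ≤ L / 4 := by
        rw [← sq_abs]
        have := Real.sq_sqrt (show (0 : ℝ) ≤ L by positivity)
        nlinarith [abs_nonneg (radSum v), Real.sqrt_nonneg (L : ℝ)]
      have h2 : 0 ≤ (L / 4 - radSum v ^ 2) * (17 / 4 * L - radSum v ^ 2) :=
        mul_nonneg (by linarith) (by linarith)
      linarith
  have hs := Finset.sum_le_sum (fun v (_ : v ∈ (Finset.univ : Finset (Fin L → Bool))) => key v)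
  rw [← Finset.mul_sum, Finset.sum_boole] at hs
  have e : ∀ v : Fin L → Bool,
      (1 / 4 : ℝ) * (radSum v ^ 2 - L / 4) * (17 / 4 * L - radSum v ^ 2) =
      (9 / 8 * L) * radSum v ^ 2 - (1 / 4) * radSum v ^ 4 - 17 / 64 * (L : ℝ) ^ 2 :=
    fun v => by ring
  simp only [e, Finset.sum_sub_distrib, ← Finset.mul_sum, moment_two, moment_four] at hs
  have hc : (((Finset.univ.filter (fun v : Fin L → Bool => √L / 2 ≤ |radSum v|)).card : ℕ) : ℝ)
      ≤ 2 * tailCard L (√L / 2) := by exact_mod_cast card_abs_le L (√L / 2)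
  simp at hs
  set T : ℝ := ((tailCard L (√L / 2) : ℕ) : ℝ) with hT
  have h3 : (L : ℝ) ^ 2 * (2 ^ L * (7 / 64)) ≤ L ^ 2 * (2 * T) := by
    have h5 := mul_le_mul_of_nonneg_left hc (sq_nonneg (L : ℝ))
    have h6 : (0 : ℝ) ≤ 2 ^ L * L := by positivity
    nlinarith
  have h4 := le_of_mul_le_mul_left h3 (by positivity)
  have h7 : (0 : ℝ) ≤ 2 ^ L := by positivity
  have : (2 : ℝ) ^ L ≤ 32 * T := by linarith
  rw [hT] at this
  exact_mod_cast this

/-- The main tail estimate. -/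
lemma tail_main (K m r : ℕ) (hK : 1 ≤ K) (hm : 1 ≤ m) (hr : 1 ≤ r)
    (h : 4 * m ≤ r * K ^ 2) :
    ∃ a : ℝ, (m : ℝ) / (2 * K) < a ∧ 2 ^ m ≤ 2 * 32 ^ r * tailCard m a := by
  have hK' : (1 : ℝ) ≤ K := by exact_mod_cast hK
  have hm' : (1 : ℝ) ≤ m := by exact_mod_cast hm
  rcases lt_or_ge m r with hmr | hmr
  · refine ⟨m, ?_, ?_⟩
    · rw [div_lt_iff₀ (by positivity)]
      nlinarith
    · have h1 : 1 ≤ tailCard m m := by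
        classical
        unfold tailCard
        rw [Nat.one_le_iff_ne_zero, Finset.card_ne_zero]
        refine ⟨fun _ => true, Finset.mem_filter.2 ⟨Finset.mem_univ _, ?_⟩⟩
        simp [radSum, rad]
      have h2 : 2 ^ m ≤ 32 ^ r :=
        (Nat.pow_le_pow_left (by norm_num) m).trans (Nat.pow_le_pow_right (by norm_num) hmr.le)
      calc 2 ^ m ≤ 32 ^ r := h2
        _ ≤ 2 * 32 ^ r * 1 := by omega
        _ ≤ _ := Nat.mul_le_mul_left _ h1
  · set L := m / r with hL
    set q := m % r with hq
    have hdm : r * L + q = m := Nat.div_add_mod m r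
    have hqr : q < r := Nat.mod_lt _ hr
    have hL1 : 1 ≤ L := Nat.div_pos hmr hr
    refine ⟨r * (√L / 2) + 0, ?_, ?_⟩
    · have h4 : 4 * L ≤ K ^ 2 := by
        have : r * (4 * L) ≤ r * K ^ 2 := by nlinarith
        exact Nat.le_of_mul_le_mul_left this hr
      have h4' : (4 : ℝ) * L ≤ K ^ 2 := by exact_mod_cast h4
      have hs := Real.sq_sqrt (show (0 : ℝ) ≤ L by positivity)
      have hsn := Real.sqrt_nonneg (L : ℝ)
      have h5 : 2 * √L ≤ K := by
        apply le_of_sq_le_sq _ (by positivity)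
        nlinarith
      have h6 : (m : ℝ) < 2 * r * L := by
        have : m < 2 * r * L := by nlinarith
        exact_mod_cast this
      rw [div_lt_iff₀ (by positivity)]
      have h7 : (0 : ℝ) ≤ r * √L := by positivity
      nlinarith [mul_le_mul_of_nonneg_left h5 h7]
    · have h1 := tailCard_mul (r * L) q (r * (√L / 2)) 0
      rw [hdm] at h1
      have h2 := tailCard_pow L (√L / 2) r
      have h3 := tailCard_zero q
      have h4 := Nat.pow_le_pow_left (tailCard_const L hL1) r
      rw [mul_pow, ← pow_mul, mul_comm L r] at h4
      calc 2 ^ m = 2 ^ (r * L) * 2 ^ q := by rw [← pow_add, hdm]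
        _ ≤ (32 ^ r * tailCard L (√L / 2) ^ r) * (2 * tailCard q 0) := Nat.mul_le_mul h4 h3
        _ ≤ (32 ^ r * tailCard (r * L) (r * (√L / 2))) * (2 * tailCard q 0) := by gcongr
        _ = 2 * 32 ^ r * (tailCard (r * L) (r * (√L / 2)) * tailCard q 0) := by ring
        _ ≤ _ := Nat.mul_le_mul_left _ h1

open Classical in
/-- Bound on the number of matrices with small coherence, conditioning on the first column. -/
lemma good_card (m n : ℕ) (x : ℝ) :
    (Finset.univ.filter (fun ω : Fin m → Fin (n + 1) → Bool =>
      ∀ j : Fin n, |∑ k : Fin m, rad (ω k 0) * rad (ω k j.succ)| / m ≤ x)).card ≤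
    2 ^ m * (Finset.univ.filter (fun v : Fin m → Bool => |radSum v| / m ≤ x)).card ^ n := by
  set B := Finset.univ.filter (fun v : Fin m → Bool => |radSum v| / m ≤ x) with hB
  have : 2 ^ m * B.card ^ n =
      ((Finset.univ : Finset (Fin m → Bool)) ×ˢ Fintype.piFinset (fun _ : Fin n => B)).card := by
    rw [Finset.card_product]
    simp
  rw [this]
  refine Finset.card_le_card_of_injOn
    (fun ω => (fun k => ω k 0, fun j k => (ω k 0 == ω k j.succ))) ?_ ?_
  · intro ω h
    simp only [Finset.mem_coe, Finset.mem_filter, Finset.mem_univ, true_and, Finset.mem_product,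
      Fintype.mem_piFinset, hB] at h ⊢
    intro j
    have := h j
    simpa only [rad_mul, radSum] using this
  · intro ω _ ω' _ h
    simp only [Prod.mk.injEq] at h
    funext k j
    have h0 : ω k 0 = ω' k 0 := congrFun h.1 k
    refine Fin.cases h0 (fun j => ?_) j
    have h1 := congrFun (congrFun h.2 j) k
    simp only [h0] at h1
    revert h1
    cases ω' k 0 <;> cases ω k j.succ <;> cases ω' k j.succ <;> simp

lemma prob_main (m n Q : ℕ) (x a : ℝ) (hm : 1 ≤ m) (hQ : 1 ≤ Q) (hx : m * x < a)
    (hn : 2 * Q ≤ n) (h : 2 ^ m ≤ 2 * Q * tailCard m a) :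
    (1 / 2 : ℝ) ≤ coherBadProb m (n + 1) x := by
  classical
  have hm' : (0 : ℝ) < m := by exact_mod_cast hm
  set Bad := Finset.univ.filter (fun ω : Fin m → Fin (n + 1) → Bool => ∃ i j : Fin (n + 1),
    i ≠ j ∧ x < |∑ k : Fin m, rad (ω k i) * rad (ω k j)| / m) with hBad
  set Good := Finset.univ.filter (fun ω : Fin m → Fin (n + 1) → Bool =>
      ∀ j : Fin n, |∑ k : Fin m, rad (ω k 0) * rad (ω k j.succ)| / m ≤ x) with hGood
  set B := Finset.univ.filter (fun v : Fin m → Bool => |radSum v| / m ≤ x) with hB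
  have hset : {ω : Fin m → Fin (n + 1) → Bool | ∃ i j : Fin (n + 1), i ≠ j ∧
      x < |∑ k : Fin m, rad (ω k i) * rad (ω k j)| / m}.ncard = Bad.card := by
    rw [← Set.ncard_coe_finset]
    congr 1
    ext ω
    simp [hBad]
  have hcov : (Finset.univ : Finset (Fin m → Fin (n + 1) → Bool)) ⊆ Bad ∪ Good := by
    intro ω _
    by_cases hg : ω ∈ Good
    · exact Finset.mem_union_right _ hg
    · apply Finset.mem_union_left
      simp only [hGood, Finset.mem_filter, Finset.mem_univ, true_and, not_forall, not_le] at hg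
      obtain ⟨j, hj⟩ := hg
      simp only [hBad, Finset.mem_filter, Finset.mem_univ, true_and]
      exact ⟨0, j.succ, (Fin.succ_ne_zero j).symm, hj⟩
  have hcard := (Finset.card_le_card hcov).trans (Finset.card_union_le _ _)
  have hgc : Good.card ≤ 2 ^ m * B.card ^ n := good_card m n x
  have hBt : B.card + tailCard m a ≤ 2 ^ m := by
    have hd : Disjoint B (Finset.univ.filter (fun v : Fin m → Bool => a ≤ radSum v)) := by
      rw [Finset.disjoint_left]
      intro v hv hv'
      simp only [hB, Finset.mem_filter, Finset.mem_univ, true_and] at hv hv'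
      rw [div_le_iff₀ hm'] at hv
      have := le_abs_self (radSum v)
      linarith
    have h1 := Finset.card_union_of_disjoint hd
    have h2 := Finset.card_le_univ (B ∪ Finset.univ.filter (fun v : Fin m → Bool => a ≤ radSum v))
    rw [h1] at h2
    simpa [tailCard] using h2
  have hM : (0 : ℝ) < 2 ^ m := by positivity
  have hBt' : (B.card : ℝ) + tailCard m a ≤ 2 ^ m := by exact_mod_cast hBt
  have h' : (2 : ℝ) ^ m ≤ 2 * Q * tailCard m a := by exact_mod_cast h
  have hQ' : (1 : ℝ) ≤ Q := by exact_mod_cast hQ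
  have hn' : 2 * (Q : ℝ) ≤ n := by exact_mod_cast hn
  set p : ℝ := 1 / (2 * Q) with hp
  have hpT : (2 : ℝ) ^ m * p ≤ tailCard m a := by
    rw [hp, mul_one_div, div_le_iff₀ (by positivity)]
    linarith
  have hB1 : (B.card : ℝ) ≤ 2 ^ m * Real.exp (-p) := by
    have := Real.add_one_le_exp (-p)
    nlinarith
  have hpn : 1 ≤ p * n := by
    rw [hp, one_div_mul_eq_div, le_div_iff₀ (by positivity)]
    linarith
  have hB2 : (B.card : ℝ) ^ n ≤ (2 ^ m) ^ n * (1 / 2) := by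
    calc (B.card : ℝ) ^ n ≤ (2 ^ m * Real.exp (-p)) ^ n := by gcongr
      _ = (2 ^ m) ^ n * Real.exp (-(p * n)) := by
        rw [mul_pow, ← Real.exp_nat_mul]; congr 2; ring
      _ ≤ (2 ^ m) ^ n * (1 / 2) := by
        gcongr
        calc Real.exp (-(p * n)) ≤ Real.exp (-1) := by gcongr
          _ ≤ 1 / 2 := by
            rw [Real.exp_neg, one_div]
            apply inv_anti₀ (by norm_num)
            linarith [Real.add_one_le_exp (1 : ℝ)]
  have hF : (Fintype.card (Fin m → Fin (n + 1) → Bool) : ℝ) = 2 ^ m * (2 ^ m) ^ n := by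
    simp only [Fintype.card_fun, Fintype.card_bool, Fintype.card_fin]
    push_cast
    rw [← pow_mul, ← pow_mul, ← pow_add]
    congr 1
    ring
  have hc : (Fintype.card (Fin m → Fin (n + 1) → Bool) : ℝ) ≤ Bad.card + Good.card := by
    exact_mod_cast hcard
  have hg' : (Good.card : ℝ) ≤ 2 ^ m * (B.card : ℝ) ^ n := by exact_mod_cast hgc
  unfold coherBadProb
  rw [hset, le_div_iff₀ (by rw [hF]; positivity)]
  rw [hF] at hc ⊢
  have := mul_le_mul_of_nonneg_left hB2 hM.le
  linarith

/-- Converse: for every `ε > 0` and every constant `c > 0`, if `m ≤ c·K^{2−ε}·ln N` then for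
all sufficiently large `K, m, N` the probability that
`max_{i≠j} (1/m)|⟨xᵢ,xⱼ⟩| > 1/(2K)` is at least `1/2`. -/
theorem coherence_bernoulli_converse :
    ∀ ε : ℝ, 0 < ε → ∀ c : ℝ, 0 < c → ∃ K₀ m₀ N₀ : ℕ,
      ∀ K m N : ℕ, K₀ ≤ K → m₀ ≤ m → N₀ ≤ N →
        (m : ℝ) ≤ c * (K : ℝ) ^ ((2 : ℝ) - ε) * Real.log N →
        (1 / 2 : ℝ) ≤ coherBadProb m N (1 / (2 * K)) := by
  intro ε hε c hc
  have ht := (tendsto_rpow_atTop hε).comp (tendsto_natCast_atTop_atTop (R := ℝ))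
  obtain ⟨K₁, hK₁⟩ := Filter.eventually_atTop.1 (ht.eventually_ge_atTop (56 * c))
  refine ⟨max K₁ 1, 1, 1024, ?_⟩
  intro K m N hK hm hN hle
  have hK1 : 1 ≤ K := (le_max_right _ _).trans hK
  have hKc : 56 * c ≤ (K : ℝ) ^ ε := hK₁ K ((le_max_left _ _).trans hK)
  have hK' : (0 : ℝ) < K := by exact_mod_cast hK1
  set r := Nat.log 1024 N with hr
  have hr1 : 1 ≤ r := Nat.log_pos (by norm_num) hN
  have hr1' : (1 : ℝ) ≤ r := by exact_mod_cast hr1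
  have hlow : 1024 ^ r ≤ N := Nat.pow_log_le_self 1024 (by omega)
  have hup : N < 1024 ^ (r + 1) := Nat.lt_pow_succ_log_self (by norm_num) N
  have hlog : Real.log N ≤ 14 * r := by
    have h1 : Real.log N ≤ Real.log ((1024 : ℝ) ^ (r + 1)) := by
      apply Real.log_le_log
      · exact_mod_cast (by omega : 0 < N)
      · exact_mod_cast hup.le
    have h2 : Real.log (1024 : ℝ) ≤ 7 := by
      have : (1024 : ℝ) = 2 ^ 10 := by norm_num
      rw [this, Real.log_pow]
      have := Real.log_two_lt_d9
      push_cast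
      linarith
    rw [Real.log_pow] at h1
    push_cast at h1
    nlinarith
  have hmain : 4 * m ≤ r * K ^ 2 := by
    have h0 : (0 : ℝ) ≤ c * (K : ℝ) ^ ((2 : ℝ) - ε) := by positivity
    have h1 := mul_le_mul_of_nonneg_left hlog h0
    have h2 : (K : ℝ) ^ ((2 : ℝ) - ε) * (K : ℝ) ^ ε = (K : ℝ) ^ 2 := by
      rw [← Real.rpow_add hK', sub_add_cancel]
      norm_num
    have h3 : (0 : ℝ) ≤ (K : ℝ) ^ ((2 : ℝ) - ε) * r := by positivity
    have h4 := mul_le_mul_of_nonneg_left hKc h3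
    have h5 : (4 : ℝ) * m ≤ r * (K : ℝ) ^ 2 := by
      rw [← h2]
      linarith
    exact_mod_cast h5
  obtain ⟨a, ha, hta⟩ := tail_main K m r hK1 hm hr1 hmain
  obtain ⟨n, rfl⟩ : ∃ n, N = n + 1 := ⟨N - 1, by omega⟩
  have hq : 32 ≤ 32 ^ r := by
    calc 32 = 32 ^ 1 := by norm_num
      _ ≤ 32 ^ r := Nat.pow_le_pow_right (by norm_num) hr1
  have hq2 : 32 ^ r * 32 ^ r ≤ n + 1 := by
    rw [← mul_pow]
    exact hlow
  generalize 32 ^ r = q at hq hq2 hta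
  have hqn : 2 * q ≤ n := by
    have h32 : 32 * q ≤ q * q := Nat.mul_le_mul_right q hq
    clear hup hlow hN
    omega
  have hq1 : 1 ≤ q := by omega
  refine prob_main m n q _ a hm hq1 ?_ hqn hta
  rw [mul_one_div]
  exact ha
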